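/- The design O_m is a minimum aberration design among all subsets of H_m of cardinality 2^{m−1}. -/

import Mathlib

open Finset Polynomial

/-- The ambient 𝔽₂-vector space `V = (ZMod 2)^m`. -/
abbrev V (m : ℕ) := Fin m → ZMod 2

/-- `Hm m` is the set of the `2^m - 1` nonzero vectors of `V m`. -/
def Hm (m : ℕ) : Finset (V m) := Finset.univ.filter (fun v => v ≠ 0)

/-- `Om m` is the set of odd-weight vectors of `V m`. -/
def Om (m : ℕ) : Finset (V m) := Finset.univ.filter (fun v => (∑ i, v i) = 1)

/-- `Em m` is the set of nonzero even-weight vectors of `V m`. -/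
def Em (m : ℕ) : Finset (V m) := Finset.univ.filter (fun v => v ≠ 0 ∧ (∑ i, v i) = 0)

/-- The number of `i`-element subsets of `d` whose elements sum to `ψ`. -/
def sumCount (m : ℕ) (d : Finset (V m)) (i : ℕ) (ψ : V m) : ℕ :=
  ((d.powersetCard i).filter (fun S => S.sum id = ψ)).card

/-- `wordCount m d i = a_i(d)`, the number of `i`-element subsets of `d` summing to `0`. -/
def wordCount (m : ℕ) (d : Finset (V m)) (i : ℕ) : ℕ := sumCount m d i 0

/-- The rank of a finite set of vectors: the dimension of its span over `𝔽₂`. -/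
noncomputable def rankOf (m : ℕ) (f : Finset (V m)) : ℕ :=
  Module.finrank (ZMod 2) (Submodule.span (ZMod 2) (f : Set (V m)))

/-- `d₁` has smaller aberration than `d₂`. -/
def SmallerAberration (m : ℕ) (d₁ d₂ : Finset (V m)) : Prop :=
  ∃ s, 1 ≤ s ∧ wordCount m d₁ s < wordCount m d₂ s ∧
    ∀ t < s, wordCount m d₁ t = wordCount m d₂ t

/-- `d` is a minimum aberration design. -/
def IsMA (m : ℕ) (d : Finset (V m)) : Prop :=
  d ⊆ Hm m ∧ ∀ d' ⊆ Hm m, d'.card = d.card → ¬ SmallerAberration m d' d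

/-- The word-length pattern polynomial `P_f(X) = ∑ a_i(f) X^i` of a design `f`. -/
noncomputable def WLPP (m : ℕ) (f : Finset (V m)) : Polynomial ℤ :=
  ∑ i ∈ Finset.range (f.card + 1), (wordCount m f i : ℤ) • X ^ i

/-- `Q_ψ(X) = ∑ q_i(ψ) X^i`, where `q_i(ψ)` counts `i`-element subsets of `O_m` summing to `ψ`. -/
noncomputable def Qpoly (m : ℕ) (ψ : V m) : Polynomial ℤ :=
  ∑ i ∈ Finset.range ((Om m).card + 1), (sumCount m (Om m) i ψ : ℤ) • X ^ i

/-- An injective additive map carrying `d₁` into `d₂` injects words of `d₁` into words of `d₂`. -/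
theorem wordCount_le_of_mapsTo {m : ℕ} {d₁ d₂ : Finset (V m)} (e : V m →+ V m)
    (he : Function.Injective e) (h : ∀ x ∈ d₁, e x ∈ d₂) (i : ℕ) :
    wordCount m d₁ i ≤ wordCount m d₂ i := by
  unfold wordCount sumCount
  refine Finset.card_le_card_of_injOn (fun S => S.image e) ?_ (Finset.image_injective he).injOn
  intro S hS
  simp only [coe_filter, Finset.mem_powersetCard, Set.mem_ofPred_eq] at hS ⊢
  obtain ⟨⟨hSd, hcard⟩, hsum⟩ := hS
  refine ⟨⟨Finset.image_subset_iff.2 fun x hx => h x (hSd hx), ?_⟩, ?_⟩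
  · rw [Finset.card_image_of_injective _ he, hcard]
  · rw [Finset.sum_image he.injOn]
    simpa using congrArg e hsum

/-- The coordinate sum, as an additive functional. -/
def coordSum (m : ℕ) : V m →+ ZMod 2 where
  toFun v := ∑ i, v i
  map_zero' := by simp
  map_add' x y := by simp [Finset.sum_add_distrib]

theorem mem_Om {m : ℕ} {v : V m} : v ∈ Om m ↔ coordSum m v = 1 := by
  simp [Om, coordSum]

theorem V_add_self {m : ℕ} (v : V m) : v + v = 0 := by
  ext i; exact CharTwo.add_self_eq_zero _

theorem zmod_two_cases (a : ZMod 2) : a = 0 ∨ a = 1 := by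
  revert a; decide

theorem exists_mem_Om {m : ℕ} (hm : 1 ≤ m) : ∃ v, v ∈ Om m :=
  ⟨Pi.single ⟨0, hm⟩ 1, by simp [Om]⟩

theorem two_mul_card_Om {m : ℕ} (hm : 1 ≤ m) : 2 * (Om m).card = Fintype.card (V m) := by
  obtain ⟨u, hu⟩ := exists_mem_Om hm
  have hcompl : (Om m).image (u + ·) = (Om m)ᶜ := by
    ext v
    simp only [Finset.mem_image, Finset.mem_compl]
    rw [mem_Om] at hu
    constructor
    · rintro ⟨w, hw, rfl⟩
      rw [mem_Om] at hw ⊢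
      rw [map_add, hu, hw]
      decide
    · intro hv
      refine ⟨u + v, ?_, by rw [← add_assoc, V_add_self, zero_add]⟩
      rw [mem_Om] at hv ⊢
      rw [map_add, hu, (zmod_two_cases _).resolve_right hv, add_zero]
  have hcard := congrArg Finset.card hcompl
  rw [Finset.card_image_of_injective _ (add_right_injective u)] at hcard
  have := Finset.card_add_card_compl (Om m)
  omega

theorem wordCount_Om_of_odd {m i : ℕ} (hi : Odd i) : wordCount m (Om m) i = 0 := by
  unfold wordCount sumCount
  rw [Finset.card_eq_zero, Finset.filter_eq_empty_iff]
  intro S hS hsum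
  rw [Finset.mem_powersetCard] at hS
  have h := congrArg (coordSum m) hsum
  rw [map_sum, map_zero,
    Finset.sum_congr rfl (g := fun _ => 1) (fun x hx => by exact mem_Om.1 (hS.1 hx)),
    Finset.sum_const, hS.2, nsmul_one, ZMod.natCast_eq_zero_iff_even] at h
  exact Nat.not_even_iff_odd.2 hi h

theorem wordCount_two {m : ℕ} (d : Finset (V m)) : wordCount m d 2 = 0 := by
  unfold wordCount sumCount
  rw [Finset.card_eq_zero, Finset.filter_eq_empty_iff]
  intro S hS hsum
  obtain ⟨x, y, hxy, rfl⟩ := Finset.card_eq_two.1 (Finset.mem_powersetCard.1 hS).2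
  rw [Finset.sum_pair hxy] at hsum
  apply hxy
  have h : x + y = y + y := by rw [V_add_self]; exact hsum
  exact add_right_cancel h

/-- A design without words of length three is sum-free. -/
theorem add_notMem_of_wordCount_three {m : ℕ} {d : Finset (V m)} (hd : d ⊆ Hm m)
    (h : wordCount m d 3 = 0) {x y : V m} (hx : x ∈ d) (hy : y ∈ d) : x + y ∉ d := by
  intro hxy
  have hne : ∀ v ∈ d, v ≠ 0 := fun v hv => by simpa [Hm] using hd hv
  have h₁ : x ≠ y := fun e => hne _ hxy (by rw [e, V_add_self])
  have h₂ : x ≠ x + y := fun e => hne _ hy (by simpa using e)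
  have h₃ : y ≠ x + y := fun e => hne _ hx (by simpa using e)
  unfold wordCount sumCount at h
  rw [Finset.card_eq_zero, Finset.filter_eq_empty_iff] at h
  refine h (x := {x, y, x + y}) ?_ ?_
  · rw [Finset.mem_powersetCard]
    refine ⟨?_, Finset.card_eq_three.2 ⟨x, y, x + y, h₁, h₂, h₃, rfl⟩⟩
    simp [Finset.insert_subset_iff, hx, hy, hxy]
  · rw [Finset.sum_insert (by simp [h₁, hne y hy]), Finset.sum_pair h₃]
    simp only [id]
    rw [← add_assoc, V_add_self]

/-- A sum-free set of half the size of the space is the complement of a hyperplane. -/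
theorem exists_functional_of_sumFree {m : ℕ} {d : Finset (V m)}
    (hcard : 2 * d.card = Fintype.card (V m)) (hfree : ∀ x ∈ d, ∀ y ∈ d, x + y ∉ d) :
    ∃ f : V m →+ ZMod 2, ∀ v, v ∈ d ↔ f v = 1 := by
  have himage : ∀ x ∈ d, d.image (x + ·) = dᶜ := by
    intro x hx
    apply Finset.eq_of_subset_of_card_le
    · intro v hv
      obtain ⟨y, hy, rfl⟩ := Finset.mem_image.1 hv
      exact Finset.mem_compl.2 (hfree x hx y hy)
    · rw [Finset.card_image_of_injective _ (add_right_injective x)]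
      have := Finset.card_add_card_compl d
      omega
  have hmem : ∀ x ∈ d, ∀ y ∉ d, x + y ∈ d := by
    intro x hx y hy
    rw [← Finset.mem_compl, ← himage x hx] at hy
    obtain ⟨z, hz, rfl⟩ := Finset.mem_image.1 hy
    simpa [← add_assoc, V_add_self] using hz
  obtain ⟨x, hx⟩ : d.Nonempty := by
    rw [← Finset.card_pos]
    have : 0 < Fintype.card (V m) := Fintype.card_pos
    omega
  have hcompl : ∀ y ∉ d, ∀ z ∉ d, y + z ∉ d := by
    intro y hy z hz
    have h := hfree _ (hmem x hx y hy) _ (hmem x hx z hz)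
    rwa [add_add_add_comm, V_add_self, zero_add] at h
  refine ⟨AddMonoidHom.mk' (fun v => if v ∈ d then 1 else 0) ?_, fun v => ?_⟩
  swap
  · change v ∈ d ↔ (if v ∈ d then (1 : ZMod 2) else 0) = 1
    simp
  intro y z
  by_cases hy : y ∈ d <;> by_cases hz : z ∈ d
  · simp only [hy, hz, hfree y hy z hz, if_true, if_false]; decide
  · simp [hy, hz, hmem y hy z hz]
  · simp [hy, hz, add_comm y z, hmem z hz y hy]
  · simp [hy, hz, hcompl y hy z hz]

/-- Any two nonzero functionals are exchanged by an injective additive self-map of the space. -/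
theorem exists_injective_comp_eq {m : ℕ} {f g : V m →+ ZMod 2} (hf : ∃ v, f v = 1)
    (hg : ∃ v, g v = 1) : ∃ e : V m →+ V m, Function.Injective e ∧ ∀ v, f (e v) = g v := by
  obtain ⟨u, hfu, hgu⟩ : ∃ u, f u = 1 ∧ g u = 1 := by
    obtain ⟨v, hv⟩ := hf
    obtain ⟨w, hw⟩ := hg
    rcases zmod_two_cases (g v) with hgv | hgv
    · rcases zmod_two_cases (f w) with hfw | hfw
      · exact ⟨v + w, by simp [hv, hfw], by simp [hw, hgv]⟩
      · exact ⟨w, hfw, hw⟩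
    · exact ⟨v, hv, hgv⟩
  let e : V m →+ V m := AddMonoidHom.mk' (fun v => v + (f v + g v) • u) fun x y => by
    simp only [map_add, add_smul]
    abel
  have hsmul : ∀ (k : V m →+ ZMod 2) (c : ZMod 2), k u = 1 → k (c • u) = c := by
    intro k c hk
    rcases zmod_two_cases c with rfl | rfl <;> simp [hk]
  have hfe : ∀ v, f (e v) = g v := fun v => by
    change f (v + (f v + g v) • u) = g v
    rw [map_add, hsmul f _ hfu, ← add_assoc, CharTwo.add_self_eq_zero, zero_add]
  have hge : ∀ v, g (e v) = f v := fun v => by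
    change g (v + (f v + g v) • u) = f v
    rw [map_add, hsmul g _ hgu, add_left_comm, CharTwo.add_self_eq_zero, add_zero]
  refine ⟨e, Function.LeftInverse.injective (g := e) fun v => ?_, hfe⟩
  change e v + (f (e v) + g (e v)) • u = v
  rw [hfe, hge]
  change v + (f v + g v) • u + (g v + f v) • u = v
  rw [add_comm (g v), add_assoc, V_add_self, add_zero]

/-- The saturated resolution-IV design `O_m` is a minimum aberration
design among all subsets of `H_m` of cardinality `2^{m-1}`. -/
theorem Om_isMA (m : ℕ) (hm : 2 ≤ m) : IsMA m (Om m) := by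
  have hm₁ : 1 ≤ m := by omega
  refine ⟨fun v hv => ?_, fun d hd hcard => ?_⟩
  · rw [mem_Om] at hv
    simp only [Hm, Finset.mem_filter, Finset.mem_univ, true_and]
    rintro rfl
    simp at hv
  rintro ⟨s, hs, hlt, heq⟩
  have hs₁ : s ≠ 1 := by
    rintro rfl
    rw [wordCount_Om_of_odd odd_one] at hlt
    omega
  have hs₂ : s ≠ 2 := by
    rintro rfl
    rw [wordCount_two (Om m)] at hlt
    omega
  have hs₃ : s ≠ 3 := by
    rintro rfl
    rw [wordCount_Om_of_odd (by decide)] at hlt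
    omega
  have hthree : wordCount m d 3 = 0 := by
    rw [heq 3 (by omega), wordCount_Om_of_odd (by decide)]
  obtain ⟨f, hf⟩ := exists_functional_of_sumFree (by rw [hcard, two_mul_card_Om hm₁])
    fun x hx y hy => add_notMem_of_wordCount_three hd hthree hx hy
  obtain ⟨u, hu⟩ := exists_mem_Om hm₁
  obtain ⟨v, hv⟩ : d.Nonempty := by
    rw [← Finset.card_pos, hcard]
    exact Finset.card_pos.2 ⟨u, hu⟩
  obtain ⟨e, he, hfe⟩ := exists_injective_comp_eq ⟨v, (hf v).1 hv⟩ ⟨u, mem_Om.1 hu⟩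
  exact hlt.not_ge (wordCount_le_of_mapsTo e he
    (fun x hx => (hf _).2 ((hfe x).trans (mem_Om.1 hx))) s)
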